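/- For R-modules M and N with M finitely generated over a commutative Noetherian ring R, and an ideal I, if Supp N ⊆ Supp M, then the cohomological dimension of N with respect to I is at most the cohomological dimension of M with respect to I, i.e., if H^i_I(M) = 0 for all i > c, then H^i_I(N) = 0 for all i > c. -/

import Mathlib

open CategoryTheory


namespace LC
universe u
open Opposite Limits

variable {R : Type u} [CommRing R]

noncomputable def yonMap {X' X : ModuleCat.{u} R} (P' : ProjectiveResolution X')
    (P : ProjectiveResolution X) (φ : P'.complex ⟶ P.complex) (Y : ModuleCat.{u} R) :
    P.complex.linearYonedaObj R Y ⟶ P'.complex.linearYonedaObj R Y :=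
  (HomologicalComplex.unopFunctor _ _).map
    ((((linearYoneda R (ModuleCat.{u} R)).obj Y).rightOp.mapHomologicalComplex _).map φ).op

lemma yonMap_f {X' X : ModuleCat.{u} R} (P' : ProjectiveResolution X')
    (P : ProjectiveResolution X) (φ : P'.complex ⟶ P.complex) (Y : ModuleCat.{u} R) (n : ℕ)
    (f : P.complex.X n ⟶ Y) :
    ((yonMap P' P φ Y).f n) f = φ.f n ≫ f := rfl

lemma gen_chain {C : Type*} [Category C] {A B C' D E F : C} (l : A ⟶ B) (a : B ⟶ C') (b : C' ⟶ D)
    (a2 : A ⟶ E) (m : E ⟶ C') (b2 : E ⟶ F) (n : F ⟶ D) (h1 : l ≫ a = a2 ≫ m)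
    (h2 : m ≫ b = b2 ≫ n) : l ≫ (a ≫ b) = (a2 ≫ b2) ≫ n := by
  rw [reassoc_of% h1, h2, Category.assoc]

lemma isoExt_nat {X' X : ModuleCat.{u} R} (g : X' ⟶ X) (P' : ProjectiveResolution X')
    (P : ProjectiveResolution X) (φ : ProjectiveResolution.Hom P' P g) (Y : ModuleCat.{u} R)
    (n : ℕ) :
    ((_root_.Ext R (ModuleCat.{u} R) n).map g.op).app Y ≫ (P'.isoExt n Y).hom =
      (P.isoExt n Y).hom ≫ HomologicalComplex.homologyMap (yonMap P' P φ.hom Y) n := by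
  have h1 := ProjectiveResolution.isoLeftDerivedObj_inv_naturality g P' P φ.hom
    (by simpa using φ.hom_f_zero_comp_π_f_zero)
    ((linearYoneda R (ModuleCat.{u} R)).obj Y).rightOp n
  have h2 := HomologicalComplex.homologyOp_hom_naturality (yonMap P' P φ.hom Y) n
  replace h1 := congrArg Quiver.Hom.unop h1
  replace h2 := congrArg Quiver.Hom.unop h2
  refine gen_chain _ _ _ _ (h1 := h1) (m := (HomologicalComplex.homologyMap
    ((HomologicalComplex.opFunctor _ _).map (yonMap P' P φ.hom Y).op) n).unop) (h2 := ?_)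
  exact (Iso.eq_inv_comp _).2 ((Category.assoc _ _ _).symm.trans ((Iso.comp_inv_eq _).2 h2))

lemma hom_exists {X' X : ModuleCat.{u} R} (g : X' ⟶ X) (P' : ProjectiveResolution X')
    (P : ProjectiveResolution X) : Nonempty (ProjectiveResolution.Hom P' P g) :=
  ⟨⟨ProjectiveResolution.lift g P' P, by
    simpa using ProjectiveResolution.lift_commutes_zero g P' P⟩⟩


/-- class of a cocycle -/
lemma cls_surj {K : CochainComplex (ModuleCat.{u} R) ℕ} {n : ℕ} (x : K.homology n) :
    ∃ z : K.cycles n, K.homologyπ n z = x := by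
  have : Function.Surjective (K.homologyπ n) := (ModuleCat.epi_iff_surjective _).1 inferInstance
  exact this x

lemma icycles_inj {K : CochainComplex (ModuleCat.{u} R) ℕ} {n : ℕ} :
    Function.Injective (K.iCycles n) := (ModuleCat.mono_iff_injective _).1 inferInstance

lemma cls_lift {K : CochainComplex (ModuleCat.{u} R) ℕ} {n : ℕ} (f : K.X n)
    (hf : K.d n (n+1) f = 0) : ∃ z : K.cycles n, K.iCycles n z = f := by
  have h := ShortComplex.exact_of_f_is_kernel
    (ShortComplex.mk (K.iCycles n) (K.d n (n+1)) (by simp)) (K.cyclesIsKernel n (n+1) (by simp))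
  rw [ShortComplex.moduleCat_exact_iff] at h
  exact h f hf

lemma cls_eq_zero_iff {K : CochainComplex (ModuleCat.{u} R) ℕ} {p : ℕ} (z : K.cycles (p+1)) :
    K.homologyπ (p+1) z = 0 ↔ ∃ y : K.X p, K.d p (p+1) y = K.iCycles (p+1) z := by
  have h := ShortComplex.exact_of_g_is_cokernel
    (ShortComplex.mk (K.toCycles p (p+1)) (K.homologyπ (p+1)) (by simp))
    (K.homologyIsCokernel p (p+1) (by simp))
  rw [ShortComplex.moduleCat_exact_iff] at h
  constructor
  · intro hz
    obtain ⟨y, hy⟩ := h z hz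
    refine ⟨y, ?_⟩
    rw [← hy]
    exact (ConcreteCategory.congr_hom (K.toCycles_i p (p+1)) y).symm
  · rintro ⟨y, hy⟩
    have : z = K.toCycles p (p+1) y := by
      apply icycles_inj
      rw [← hy]
      exact (ConcreteCategory.congr_hom (K.toCycles_i p (p+1)) y).symm
    rw [this]
    exact (ConcreteCategory.congr_hom (K.toCycles_comp_homologyπ p (p+1)) y)

/-- corresponding classes in the two versions of Ext -/
def Rel {X Y : ModuleCat.{u} R} {p : ℕ}
    (x : ((_root_.Ext R (ModuleCat.{u} R) (p+1)).obj (op X)).obj Y) (y : Abelian.Ext X Y (p+1)) :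
    Prop :=
  ∃ (f : (projectiveResolution X).complex.X (p+1) ⟶ Y)
    (hf : (projectiveResolution X).complex.d (p+2) (p+1) ≫ f = 0)
    (z : ((projectiveResolution X).complex.linearYonedaObj R Y).cycles (p+1)),
    HomologicalComplex.iCycles ((projectiveResolution X).complex.linearYonedaObj R Y) (p+1) z = f ∧
    ((projectiveResolution X).isoExt (p+1) Y).hom x = HomologicalComplex.homologyπ ((projectiveResolution X).complex.linearYonedaObj R Y) (p+1) z ∧
    (projectiveResolution X).extMk f (p+2) rfl hf = y

lemma Rel.exists_right {X Y : ModuleCat.{u} R} {p : ℕ}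
    (x : ((_root_.Ext R (ModuleCat.{u} R) (p+1)).obj (op X)).obj Y) : ∃ y, Rel x y := by
  obtain ⟨z, hz⟩ := cls_surj (((projectiveResolution X).isoExt (p+1) Y).hom x)
  exact ⟨_, _, (ConcreteCategory.congr_hom (HomologicalComplex.iCycles_d _ (p+1) (p+2)) z), z, rfl,
    hz.symm, rfl⟩

lemma Rel.exists_left {X Y : ModuleCat.{u} R} {p : ℕ} (y : Abelian.Ext X Y (p+1)) :
    ∃ x : ((_root_.Ext R (ModuleCat.{u} R) (p+1)).obj (op X)).obj Y, Rel x y := by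
  obtain ⟨f, hf, h⟩ := (projectiveResolution X).extMk_surjective y (p+2) rfl
  obtain ⟨z, hz⟩ := cls_lift (K := (projectiveResolution X).complex.linearYonedaObj R Y) f hf
  exact ⟨((projectiveResolution X).isoExt (p+1) Y).inv (HomologicalComplex.homologyπ ((projectiveResolution X).complex.linearYonedaObj R Y) (p+1) z),
    f, hf, z, hz, by simp, h⟩

lemma Rel.zero_iff {X Y : ModuleCat.{u} R} {p : ℕ}
    {x : ((_root_.Ext R (ModuleCat.{u} R) (p+1)).obj (op X)).obj Y} {y : Abelian.Ext X Y (p+1)}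
    (h : Rel x y) : x = 0 ↔ y = 0 := by
  obtain ⟨f, hf, z, hz, hx, rfl⟩ := h
  rw [ProjectiveResolution.extMk_eq_zero_iff _ _ _ _ _ p rfl]
  have h1 : x = 0 ↔ ((projectiveResolution X).isoExt (p+1) Y (R := R)).hom x = 0 := by
    constructor
    · rintro rfl; simp
    · intro h
      have := congrArg ((projectiveResolution X).isoExt (p+1) Y (R := R)).inv h
      simpa using this
  rw [h1, hx, cls_eq_zero_iff, hz]
  rfl

lemma Rel.map {X X' Y : ModuleCat.{u} R} {p : ℕ}
    {x : ((_root_.Ext R (ModuleCat.{u} R) (p+1)).obj (op X)).obj Y} {y : Abelian.Ext X Y (p+1)}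
    (h : Rel x y) (g : X' ⟶ X) :
    Rel ((((_root_.Ext R (ModuleCat.{u} R) (p+1)).map g.op).app Y) x)
      ((Abelian.Ext.mk₀ g).comp y (zero_add _)) := by
  obtain ⟨f, hf, z, hz, hx, rfl⟩ := h
  obtain ⟨φ⟩ := hom_exists g (projectiveResolution X') (projectiveResolution X)
  refine ⟨φ.hom.f (p+1) ≫ f, _, HomologicalComplex.cyclesMap (yonMap _ _ φ.hom Y) (p+1) z, ?_, ?_,
    (ProjectiveResolution.mk₀_comp_extMk _ _ _ _ φ).symm⟩
  · rw [← yonMap_f, ← hz]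
    exact (ConcreteCategory.congr_hom (HomologicalComplex.cyclesMap_i
      (yonMap _ _ φ.hom Y) (p+1)) z)
  · have h1 := ConcreteCategory.congr_hom
      (isoExt_nat g (projectiveResolution X') (projectiveResolution X) φ Y (p+1)) x
    have h2 := ConcreteCategory.congr_hom (HomologicalComplex.homologyπ_naturality
      (yonMap _ _ φ.hom Y) (p+1)) z
    refine h1.trans (Eq.trans ?_ h2)
    exact congrArg _ hx

/-- transition map -/
def qmap (I : Ideal R) {t t' : ℕ} (h : t ≤ t') :
    ModuleCat.of R (R ⧸ I ^ t') ⟶ ModuleCat.of R (R ⧸ I ^ t) :=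
  ModuleCat.ofHom (Submodule.mapQ _ _ LinearMap.id (Ideal.pow_le_pow_right h))

lemma qmap_comp (I : Ideal R) {t t' t'' : ℕ} (h : t ≤ t') (h' : t' ≤ t'') :
    qmap I h' ≫ qmap I h = qmap I (h.trans h') := by
  ext
  rfl

/-- Restriction of an Ext class along a transition map. -/
noncomputable def res (I : Ideal R) {t t' : ℕ} (h : t ≤ t') {N : ModuleCat.{u} R} {i : ℕ}
    (x : Abelian.Ext (ModuleCat.of R (R ⧸ I ^ t)) N i) :
    Abelian.Ext (ModuleCat.of R (R ⧸ I ^ t')) N i :=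
  (Abelian.Ext.mk₀ (qmap I h)).comp x (zero_add _)

/-- Vanishing of the direct limit of `Ext^i(R/I^t, N)`. -/
def V (I : Ideal R) (i : ℕ) (N : ModuleCat.{u} R) : Prop :=
  ∀ (t : ℕ) (x : Abelian.Ext (ModuleCat.of R (R ⧸ I ^ t)) N i), ∃ (t' : ℕ) (h : t ≤ t'),
    res I h x = 0

lemma subs_iff (I : Ideal R) (p : ℕ) (N : ModuleCat.{u} R) :
    Subsingleton ((localCohomology I (p+1)).obj N) ↔ V I (p+1) N := by
  let F : ℕᵒᵖᵒᵖ ⥤ ModuleCat.{u} R ⥤ ModuleCat.{u} R :=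
    localCohomology.diagram (localCohomology.idealPowersDiagram I) (p+1)
  let G := F ⋙ (evaluation _ _).obj N
  have e : (localCohomology I (p+1)).obj N ≅ colimit G :=
    colimitObjIsoColimitCompEvaluation F N
  have e' : ((localCohomology I (p+1)).obj N) ≃ (colimit G : ModuleCat.{u} R) :=
    e.toLinearEquiv.toEquiv
  rw [e'.subsingleton_congr]
  have : PreservesFilteredColimitsOfSize.{0, 0} (forget (ModuleCat.{u} R)) :=
    preservesFilteredColimitsOfSize_shrink.{0, u, 0, u} _
  constructor
  · intro h t y
    obtain ⟨x, hx⟩ := Rel.exists_left (R := R) y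
    obtain ⟨j, i, hi⟩ := Concrete.colimit_rep_eq_zero R G (op (op t)) x (Subsingleton.elim _ _)
    have hle : t ≤ unop (unop j) := i.unop.unop.down.down
    refine ⟨_, hle, ?_⟩
    unfold res
    rw [← (hx.map _).zero_iff]
    exact hi
  · intro h
    refine subsingleton_of_forall_eq 0 fun x => ?_
    obtain ⟨j, x, rfl⟩ := Concrete.colimit_exists_rep G x
    obtain ⟨y, hx⟩ := Rel.exists_right (R := R) x
    obtain ⟨t', ht, hs⟩ := h _ y
    have hs := (hx.map (qmap I ht)).zero_iff.2 hs
    let i : j ⟶ op (op t') := (homOfLE ht).op.op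
    have : (G.map i) x = 0 := hs
    rw [← ConcreteCategory.congr_hom (colimit.w G i) x]
    change colimit.ι G _ (G.map i x) = 0
    rw [this, map_zero]

lemma res_res (I : Ideal R) {t t' t'' : ℕ} (h : t ≤ t') (h' : t' ≤ t'') {N : ModuleCat.{u} R}
    {i : ℕ} (x : Abelian.Ext (ModuleCat.of R (R ⧸ I ^ t)) N i) :
    res I h' (res I h x) = res I (h.trans h') x := by
  unfold res
  rw [Abelian.Ext.mk₀_comp_mk₀_assoc, qmap_comp]

lemma res_comp (I : Ideal R) {t t' : ℕ} (h : t ≤ t') {N N' : ModuleCat.{u} R}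
    {i j k : ℕ} (x : Abelian.Ext (ModuleCat.of R (R ⧸ I ^ t)) N i) (y : Abelian.Ext N N' j)
    (hk : i + j = k) :
    res I h (x.comp y hk) = (res I h x).comp y hk := by
  unfold res
  rw [Abelian.Ext.comp_assoc _ _ _ (zero_add _) hk (by lia)]

open Abelian in
lemma V.mid {I : Ideal R} {S : ShortComplex (ModuleCat.{u} R)} (hS : S.ShortExact) {i : ℕ}
    (h1 : V I i S.X₁) (h3 : V I i S.X₃) : V I i S.X₂ := by
  intro t x
  obtain ⟨t', ht, h⟩ := h3 t (x.comp (Ext.mk₀ S.g) (add_zero _))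
  rw [res_comp] at h
  obtain ⟨y, hy⟩ := Ext.covariant_sequence_exact₂ _ hS _ h
  obtain ⟨t'', ht', h'⟩ := h1 t' y
  refine ⟨t'', ht.trans ht', ?_⟩
  rw [← res_res I ht ht', ← hy, res_comp, h', Ext.zero_comp]

open Abelian in
lemma V.right {I : Ideal R} {S : ShortComplex (ModuleCat.{u} R)} (hS : S.ShortExact) {i : ℕ}
    (h2 : V I i S.X₂) (h1 : V I (i + 1) S.X₁) : V I i S.X₃ := by
  intro t x
  obtain ⟨t', ht, h⟩ := h1 t (x.comp hS.extClass rfl)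
  rw [res_comp] at h
  obtain ⟨y, hy⟩ := Ext.covariant_sequence_exact₃ _ hS _ _ h
  obtain ⟨t'', ht', h'⟩ := h2 t' y
  refine ⟨t'', ht.trans ht', ?_⟩
  rw [← res_res I ht ht', ← hy, res_comp, h', Ext.zero_comp]

open Abelian in
lemma V.left {I : Ideal R} {S : ShortComplex (ModuleCat.{u} R)} (hS : S.ShortExact) {i : ℕ}
    (h3 : V I i S.X₃) (h2 : V I (i + 1) S.X₂) : V I (i + 1) S.X₁ := by
  intro t x
  obtain ⟨t', ht, h⟩ := h2 t (x.comp (Ext.mk₀ S.f) (add_zero _))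
  rw [res_comp] at h
  obtain ⟨y, hy⟩ := Ext.covariant_sequence_exact₁ _ hS _ h rfl
  obtain ⟨t'', ht', h'⟩ := h3 t' y
  refine ⟨t'', ht.trans ht', ?_⟩
  rw [← res_res I ht ht', ← hy, res_comp, h', Ext.zero_comp]

/-- Short exact sequences from linear maps. -/
lemma mkSES {A B C : Type u} [AddCommGroup A] [AddCommGroup B] [AddCommGroup C] [Module R A]
    [Module R B] [Module R C] (f : A →ₗ[R] B) (g : B →ₗ[R] C) (hf : Function.Injective f)
    (hg : Function.Surjective g) (hfg : Function.Exact f g) :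
    (ShortComplex.mk (ModuleCat.ofHom f) (ModuleCat.ofHom g)
      (by ext x; exact hfg.apply_apply_eq_zero x)).ShortExact where
  exact := by
    rw [ShortComplex.moduleCat_exact_iff]
    intro x hx
    exact (hfg x).1 hx
  mono_f := (ModuleCat.mono_iff_injective _).2 hf
  epi_g := (ModuleCat.epi_iff_surjective _).2 hg

section les
variable {A B C : Type u} [AddCommGroup A] [AddCommGroup B] [AddCommGroup C] [Module R A]
    [Module R B] [Module R C] {f : A →ₗ[R] B} {g : B →ₗ[R] C} {I : Ideal R} {i : ℕ}

lemma V.mid' (hf : Function.Injective f)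
    (hg : Function.Surjective g) (hfg : Function.Exact f g)
    (h1 : V I i (.of R A)) (h3 : V I i (.of R C)) : V I i (.of R B) :=
  V.mid (mkSES f g hf hg hfg) h1 h3

lemma V.right' (hf : Function.Injective f)
    (hg : Function.Surjective g) (hfg : Function.Exact f g)
    (h2 : V I i (.of R B)) (h1 : V I (i + 1) (.of R A)) : V I i (.of R C) :=
  V.right (mkSES f g hf hg hfg) h2 h1

lemma V.left' (hf : Function.Injective f)
    (hg : Function.Surjective g) (hfg : Function.Exact f g)
    (h3 : V I i (.of R C)) (h2 : V I (i + 1) (.of R B)) : V I (i + 1) (.of R A) :=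
  V.left (mkSES f g hf hg hfg) h3 h2
end les

lemma V.of_equiv {I : Ideal R} {i : ℕ} {A B : Type u} [AddCommGroup A] [AddCommGroup B]
    [Module R A] [Module R B] (e : A ≃ₗ[R] B) (h : V I i (.of R A)) : V I i (.of R B) := by
  intro t x
  obtain ⟨t', ht, h⟩ := h t (x.comp (Abelian.Ext.mk₀ (ModuleCat.ofHom e.symm.toLinearMap))
    (add_zero _))
  refine ⟨t', ht, ?_⟩
  rw [res_comp] at h
  have h := congrArg (fun y => y.comp (Abelian.Ext.mk₀ (ModuleCat.ofHom e.toLinearMap))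
    (add_zero _)) h
  simp only [Abelian.Ext.zero_comp] at h
  rw [Abelian.Ext.comp_assoc _ _ _ (add_zero _) (add_zero _) (by lia), Abelian.Ext.mk₀_comp_mk₀,
    ← ModuleCat.ofHom_comp, LinearEquiv.comp_symm] at h
  rw [← h]
  exact (Abelian.Ext.comp_mk₀_id _).symm

lemma V.of_subsingleton {I : Ideal R} {i : ℕ} (A : Type u) [AddCommGroup A]
    [Module R A] [Subsingleton A] : V I i (.of R A) := by
  intro t x
  refine ⟨t, le_rfl, ?_⟩
  rw [← Abelian.Ext.comp_mk₀_id (res I _ x)]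
  have : 𝟙 (ModuleCat.of R A) = 0 := by ext; exact Subsingleton.elim _ _
  rw [this, Abelian.Ext.mk₀_zero, Abelian.Ext.comp_zero]

/-- If an element of `I` acts bijectively then all local cohomology vanishes. -/
lemma V.of_bij {I : Ideal R} {i : ℕ} (A : Type u) [AddCommGroup A]
    [Module R A] (r : R) (hr : r ∈ I) (hb : Function.Bijective (fun a : A => r • a)) :
    V I i (.of R A) := by
  intro t x
  refine ⟨t, le_rfl, ?_⟩
  generalize res I _ x = y
  have hb' : Function.Bijective (r ^ t • LinearMap.id : A →ₗ[R] A) := by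
    have : ((r ^ t • LinearMap.id : A →ₗ[R] A) : A → A) = (fun a : A => r • a)^[t] := by
      ext a; simp [smul_iterate]
    rw [this]; exact hb.iterate t
  let e := LinearEquiv.ofBijective _ hb'
  have h0 : r ^ t • y = 0 := by
    rw [← Abelian.Ext.mk₀_id_comp y, ← Abelian.Ext.smul_comp, ← Abelian.Ext.mk₀_smul]
    have : r ^ t • 𝟙 (ModuleCat.of R (R ⧸ I ^ t)) = 0 := by
      ext
      change r ^ t • (Submodule.Quotient.mk 1 : R ⧸ I ^ t) = 0
      rw [← Submodule.Quotient.mk_smul, Submodule.Quotient.mk_eq_zero]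
      simpa using Ideal.pow_mem_pow hr t
    rw [this, Abelian.Ext.mk₀_zero, Abelian.Ext.zero_comp]
  rw [← Abelian.Ext.comp_mk₀_id y, ← Abelian.Ext.comp_smul, ← Abelian.Ext.mk₀_smul] at h0
  have h := congrArg (fun y => y.comp (Abelian.Ext.mk₀ (ModuleCat.ofHom e.symm.toLinearMap))
    (add_zero _)) h0
  simp only [Abelian.Ext.zero_comp] at h
  rw [Abelian.Ext.comp_assoc _ _ _ (add_zero _) (add_zero _) (by lia), Abelian.Ext.mk₀_comp_mk₀]
    at h
  have h2 : (r ^ t • 𝟙 (ModuleCat.of R A)) ≫ ModuleCat.ofHom e.symm.toLinearMap = 𝟙 _ := by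
    ext a
    exact e.symm_apply_apply a
  rwa [h2, Abelian.Ext.comp_mk₀_id] at h

end LC

namespace LC
universe u
open Opposite Limits
variable {R : Type u} [CommRing R]

/-- Every element is killed by powers of elements of `J`. -/
def Tor (J : Ideal R) (N : Type u) [AddCommGroup N] [Module R N] : Prop :=
  ∀ x ∈ J, ∀ n : N, ∃ k : ℕ, x ^ k • n = 0

lemma Tor.exists_pow [IsNoetherianRing R] {I : Ideal R} {N X : Type u} [AddCommGroup N]
    [Module R N] [AddCommGroup X] [Module R X] [Module.Finite R X] (hN : Tor I N)
    (f : X →ₗ[R] N) : ∃ k : ℕ, I ^ k • (⊤ : Submodule R X) ≤ LinearMap.ker f := by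
  obtain ⟨s, hs⟩ := (Module.Finite.fg_top : (⊤ : Submodule R X).FG)
  have h1 : I ≤ ((LinearMap.range f).annihilator).radical := by
    intro x hx
    choose k hk using fun n => hN x hx n
    refine ⟨s.sup (fun a => k (f a)), ?_⟩
    rw [LinearMap.range_eq_map, ← hs, Submodule.map_span, Submodule.mem_annihilator_span]
    rintro ⟨_, a, ha, rfl⟩
    obtain ⟨c, hc⟩ := Nat.exists_eq_add_of_le (Finset.le_sup (f := fun a => k (f a)) ha)
    simp only at hc ⊢
    rw [hc, add_comm, pow_add, mul_smul, hk, smul_zero]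
  obtain ⟨k, hk⟩ := Ideal.exists_pow_le_of_le_radical_of_fg h1 (IsNoetherian.noetherian I)
  refine ⟨k, ?_⟩
  rw [Submodule.smul_le]
  intro r hr n _
  rw [LinearMap.mem_ker, map_smul]
  exact Submodule.mem_annihilator.1 (hk hr) _ ⟨n, rfl⟩

/-- Naturality of connecting maps: restriction kills. -/
lemma restr_zero {S₁ S₂ : ShortComplex (ModuleCat.{u} R)} (h₁ : S₁.ShortExact)
    (h₂ : S₂.ShortExact) (φ : S₁ ⟶ S₂) {N : ModuleCat.{u} R} {i j : ℕ}
    (y : Abelian.Ext S₂.X₁ N i) (h : 1 + i = j)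
    (hy : (Abelian.Ext.mk₀ φ.τ₁).comp y (zero_add _) = 0) :
    (Abelian.Ext.mk₀ φ.τ₃).comp (h₂.extClass.comp y h) (zero_add _) = 0 := by
  have := ShortComplex.ShortExact.extClass_naturality h₁ h₂ φ
  rw [← Abelian.Ext.comp_assoc _ _ _ (zero_add 1) h (by lia), ← this,
    Abelian.Ext.comp_assoc _ _ _ (add_zero 1) (zero_add _) (by lia), hy, Abelian.Ext.comp_zero]

/-- Restricting to a submodule. -/
noncomputable def incl {X : Type u} [AddCommGroup X] [Module R X] (S : Submodule R X) :
    ModuleCat.of R S ⟶ ModuleCat.of R X := ModuleCat.ofHom S.subtype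

lemma exists_free (X : Type u) [AddCommGroup X] [Module R X] [Module.Finite R X] :
    ∃ (F : Type u) (_ : AddCommGroup F) (_ : Module R F) (g : F →ₗ[R] X), Module.Finite R F ∧
      Module.Projective R F ∧ Function.Surjective g := by
  obtain ⟨n, g, hg⟩ := Module.Finite.exists_fin' R X
  exact ⟨Fin n → R, inferInstance, inferInstance, g, inferInstance, inferInstance, hg⟩

lemma tor_key [IsNoetherianRing R] {I : Ideal R} {N : Type u} [AddCommGroup N]
    [Module R N] (hN : Tor I N) (i : ℕ) : ∀ {X : Type u} [AddCommGroup X] [Module R X]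
    [Module.Finite R X] (x : Abelian.Ext (ModuleCat.of R X) (ModuleCat.of R N) i),
    ∃ k : ℕ, (Abelian.Ext.mk₀ (incl (I ^ k • (⊤ : Submodule R X)))).comp x (zero_add _) = 0 := by
  induction i with
  | zero =>
    intro X _ _ _ x
    obtain ⟨f, rfl⟩ := Abelian.Ext.homEquiv₀.symm.surjective x
    obtain ⟨k, hk⟩ := hN.exists_pow f.hom
    refine ⟨k, ?_⟩
    have : incl (I ^ k • (⊤ : Submodule R X)) ≫ f = 0 := by
      ext a
      exact hk a.2
    simp [Abelian.Ext.homEquiv₀, this]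
  | succ i ih =>
    intro X _ _ _ x
    obtain ⟨F, _, _, g, _, _, hg⟩ := exists_free (R := R) X
    have hS := mkSES (LinearMap.ker g).subtype g (Submodule.subtype_injective _) hg
      (LinearMap.exact_subtype_ker_map g)
    have : Projective (ModuleCat.of R F) := inferInstance
    obtain ⟨y, hy⟩ := Abelian.Ext.contravariant_sequence_exact₃ hS _ x
      (Abelian.Ext.eq_zero_of_projective _) (add_comm 1 i)
    obtain ⟨s, hs⟩ := ih y
    obtain ⟨k, hk⟩ := Ideal.exists_pow_inf_eq_pow_smul I (LinearMap.ker g)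
    have hle : I ^ (k + s) • (⊤ : Submodule R F) ⊓ LinearMap.ker g ≤
        I ^ s • LinearMap.ker g := by
      have := hk (k + s) (by lia)
      simp only [Nat.add_sub_cancel_left] at this
      rw [this]
      exact Submodule.smul_mono le_rfl inf_le_right
    refine ⟨k + s, ?_⟩
    have hmap : I ^ (k + s) • (⊤ : Submodule R F) ≤
        (I ^ (k + s) • (⊤ : Submodule R X)).comap g := by
      rw [Submodule.smul_le]
      intro r hr n _
      rw [Submodule.mem_comap, map_smul]
      exact Submodule.smul_mem_smul hr trivial
    let g' := g.restrict (p := I ^ (k + s) • (⊤ : Submodule R F))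
      (q := I ^ (k + s) • (⊤ : Submodule R X)) (fun x hx => hmap hx)
    have hg' : Function.Surjective g' := by
      rintro ⟨a, ha⟩
      have : (I ^ (k + s) • (⊤ : Submodule R X)) = (I ^ (k + s) • (⊤ : Submodule R F)).map g := by
        rw [Submodule.map_smul'', Submodule.map_top, LinearMap.range_eq_top.2 hg]
      rw [this] at ha
      obtain ⟨b, hb, rfl⟩ := ha
      exact ⟨⟨b, hb⟩, rfl⟩
    have hS' := mkSES (LinearMap.ker g').subtype g' (Submodule.subtype_injective _) hg'
      (LinearMap.exact_subtype_ker_map g')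
    let φ1 : LinearMap.ker g' →ₗ[R] LinearMap.ker g :=
      (I ^ (k + s) • (⊤ : Submodule R F)).subtype.restrict (by
        intro a ha
        exact congrArg Subtype.val ha)
    rw [← hy]
    refine restr_zero hS' hS
      { τ₁ := ModuleCat.ofHom φ1
        τ₂ := incl _
        τ₃ := incl _
        comm₁₂ := by ext; rfl
        comm₂₃ := by ext; rfl } y _ ?_
    change (Abelian.Ext.mk₀ (ModuleCat.ofHom φ1)).comp y _ = 0
    have hφ1 : ∀ a, φ1 a ∈ (I ^ s • (⊤ : Submodule R (LinearMap.ker g))) := by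
      intro a
      have : (φ1 a : F) ∈ I ^ s • LinearMap.ker g := hle ⟨a.1.2, (φ1 a).2⟩
      have e : I ^ s • LinearMap.ker g =
          (I ^ s • (⊤ : Submodule R (LinearMap.ker g))).map (LinearMap.ker g).subtype := by
        rw [Submodule.map_smul'', Submodule.map_top, Submodule.range_subtype]
      rw [e] at this
      obtain ⟨b, hb, hb'⟩ := this
      rwa [← Subtype.ext hb']
    have hfac : ModuleCat.ofHom φ1 = ModuleCat.ofHom (φ1.codRestrict _ hφ1) ≫ incl _ := by
      ext; rfl
    rw [hfac, ← Abelian.Ext.mk₀_comp_mk₀_assoc, hs, Abelian.Ext.comp_zero]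

lemma V.of_tor [IsNoetherianRing R] {I : Ideal R} {N : Type u} [AddCommGroup N]
    [Module R N] (hN : Tor I N) (i : ℕ) : V I (i + 1) (.of R N) := by
  intro t x
  have ses (t : ℕ) := mkSES (I ^ t).subtype (I ^ t).mkQ (Submodule.subtype_injective _)
    (Submodule.mkQ_surjective _) (LinearMap.exact_subtype_mkQ _)
  have : Projective (ModuleCat.of R R) := inferInstance
  obtain ⟨y, hy⟩ := Abelian.Ext.contravariant_sequence_exact₃ (ses t) _ x
      (Abelian.Ext.eq_zero_of_projective _) (add_comm 1 i)
  obtain ⟨s, hs⟩ := tor_key hN i y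
  have ht : t ≤ t + s := by lia
  refine ⟨t + s, ht, ?_⟩
  let φ1 : ↥(I ^ (t + s)) →ₗ[R] ↥(I ^ t) := Submodule.inclusion (Ideal.pow_le_pow_right ht)
  rw [← hy]
  refine restr_zero (ses (t + s)) (ses t)
    { τ₁ := ModuleCat.ofHom φ1
      τ₂ := 𝟙 _
      τ₃ := qmap I ht
      comm₁₂ := by ext; rfl
      comm₂₃ := by ext; rfl } y _ ?_
  change (Abelian.Ext.mk₀ (ModuleCat.ofHom φ1)).comp y _ = 0
  have hφ1 : ∀ a, φ1 a ∈ (I ^ s • (⊤ : Submodule R ↥(I ^ t))) := by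
    intro a
    have e : I ^ (t + s) = (I ^ s • (⊤ : Submodule R ↥(I ^ t))).map (I ^ t).subtype := by
      rw [Submodule.map_smul'', Submodule.map_top, Submodule.range_subtype, add_comm, pow_add]
      rfl
    obtain ⟨b, hb, hb'⟩ := e.le a.2
    have : b = φ1 a := Subtype.ext hb'
    rwa [← this]
  have hfac : ModuleCat.ofHom φ1 = ModuleCat.ofHom (φ1.codRestrict _ hφ1) ≫ incl _ := by
    ext; rfl
  rw [hfac, ← Abelian.Ext.mk₀_comp_mk₀_assoc, hs, Abelian.Ext.comp_zero]

end LC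

namespace LC
universe u
open Opposite Limits
variable {R : Type u} [CommRing R]

lemma Tor_iff {J : Ideal R} {N : Type u} [AddCommGroup N] [Module R N] : Tor J N ↔
    ∀ n : N, J ≤ Ideal.radical (LinearMap.ker (LinearMap.toSpanSingleton R N n)) := by
  unfold Tor
  constructor
  · intro h n x hx
    obtain ⟨k, hk⟩ := h x hx n
    exact ⟨k, by simpa using hk⟩
  · intro h x hx n
    obtain ⟨k, hk⟩ := h n hx
    exact ⟨k, by simpa using hk⟩

lemma Tor.sup {J K : Ideal R} {N : Type u} [AddCommGroup N] [Module R N] (h : Tor J N)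
    (h' : Tor K N) : Tor (J ⊔ K) N := by
  rw [Tor_iff] at *
  exact fun n => sup_le (h n) (h' n)

lemma Tor.single {x : R} {N : Type u} [AddCommGroup N] [Module R N]
    (h : ∀ n : N, ∃ k : ℕ, x ^ k • n = 0) : Tor (Ideal.span {x}) N := by
  intro y hy n
  obtain ⟨k, hk⟩ := h n
  obtain ⟨c, rfl⟩ := Ideal.mem_span_singleton'.1 hy
  exact ⟨k, by rw [mul_pow, mul_smul, hk, smul_zero]⟩

lemma Tor.of_injective {J : Ideal R} {N N' : Type u} [AddCommGroup N] [Module R N]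
    [AddCommGroup N'] [Module R N'] (f : N' →ₗ[R] N) (hf : Function.Injective f)
    (h : Tor J N) : Tor J N' := by
  intro x hx n
  obtain ⟨k, hk⟩ := h x hx (f n)
  exact ⟨k, hf (by rw [map_smul, hk, map_zero])⟩

lemma Tor.of_surjective {J : Ideal R} {N N' : Type u} [AddCommGroup N] [Module R N]
    [AddCommGroup N'] [Module R N'] (f : N →ₗ[R] N') (hf : Function.Surjective f)
    (h : Tor J N) : Tor J N' := by
  intro x hx n
  obtain ⟨n, rfl⟩ := hf n
  obtain ⟨k, hk⟩ := h x hx n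
  exact ⟨k, by rw [← map_smul, hk, map_zero]⟩

lemma Tor.localized {J : Ideal R} {N : Type u} [AddCommGroup N] [Module R N] (S : Submonoid R)
    (h : Tor J N) : Tor J (LocalizedModule S N) := by
  intro x hx n
  induction n using LocalizedModule.induction_on with | h m s =>
  obtain ⟨k, hk⟩ := h x hx m
  exact ⟨k, by rw [LocalizedModule.smul'_mk, hk, LocalizedModule.zero_mk]⟩

lemma Tor.mono {J K : Ideal R} {N : Type u} [AddCommGroup N] [Module R N] (hJ : K ≤ J)
    (h : Tor J N) : Tor K N := fun x hx n => h x (hJ hx) n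

lemma V.of_card [IsNoetherianRing R] {I : Ideal R} [DecidableEq R] (s : Finset R) :
    (∀ x ∈ s, x ∈ I) → ∀ J : Ideal R, I ≤ J ⊔ Ideal.span s →
    ∀ (N : Type u) [AddCommGroup N] [Module R N], Tor J N →
    ∀ i : ℕ, s.card < i → V I i (.of R N) := by
  induction s using Finset.induction_on with
  | empty =>
    intro _ J hJ N _ _ hN i hi
    obtain ⟨i, rfl⟩ := Nat.exists_eq_succ_of_ne_zero (by lia : i ≠ 0)
    exact V.of_tor (hN.mono (by simpa using hJ)) i
  | insert x s hx ih =>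
    intro hs J hJ N _ _ hN i hi
    rw [Finset.card_insert_of_notMem hx] at hi
    have ih' := ih (fun y hy => hs y (Finset.mem_insert_of_mem hy)) (J ⊔ Ideal.span {x})
      (by rwa [sup_assoc, ← Ideal.span_union, Set.singleton_union, ← Finset.coe_insert])
    let L := LocalizedModule (Submonoid.powers x) N
    let f : N →ₗ[R] L := LocalizedModule.mkLinearMap _ _
    have hL : Tor J L := hN.localized _
    have hVL : ∀ i, V I i (.of R L) := fun i => V.of_bij L x (hs x (by simp)) (by
      have := IsLocalizedModule.map_units f ⟨x, Submonoid.mem_powers x⟩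
      exact (Module.End.isUnit_iff _).1 this)
    have hK : Tor (J ⊔ Ideal.span {x}) (LinearMap.ker f) := by
      refine (hN.of_injective _ (Submodule.subtype_injective _)).sup (Tor.single ?_)
      rintro ⟨n, hn⟩
      obtain ⟨⟨_, k, rfl⟩, hc⟩ := (IsLocalizedModule.eq_zero_iff (Submonoid.powers x) f).1 hn
      exact ⟨k, Subtype.ext hc⟩
    have hQ : Tor (J ⊔ Ideal.span {x}) (L ⧸ LinearMap.range f) := by
      refine (hL.of_surjective _ (Submodule.mkQ_surjective _)).sup (Tor.single ?_)
      intro q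
      obtain ⟨l, rfl⟩ := Submodule.mkQ_surjective _ q
      obtain ⟨⟨m, ⟨_, k, rfl⟩⟩, hc⟩ := IsLocalizedModule.surj (Submonoid.powers x) f l
      refine ⟨k, ?_⟩
      rw [← map_smul]
      have : x ^ k • l = f m := hc
      rw [this]
      simp
    obtain ⟨j, rfl⟩ := Nat.exists_eq_succ_of_ne_zero (by lia : i ≠ 0)
    have h1 : V I (j + 1) (.of R (LinearMap.range f)) :=
      V.left' (Submodule.subtype_injective _) (Submodule.mkQ_surjective _)
        (LinearMap.exact_subtype_mkQ _) (ih' _ hQ j (by lia)) (hVL _)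
    exact V.mid' (Submodule.subtype_injective _) f.surjective_rangeRestrict
      (by rw [LinearMap.exact_iff, LinearMap.ker_rangeRestrict, Submodule.range_subtype])
      (ih' _ hK (j + 1) (by lia)) h1

lemma V.eventually [IsNoetherianRing R] (I : Ideal R) : ∃ n : ℕ, ∀ i, n < i →
    ∀ (N : Type u) [AddCommGroup N] [Module R N], V I i (.of R N) := by
  classical
  obtain ⟨s, hs⟩ := IsNoetherian.noetherian I
  refine ⟨s.card, fun i hi N _ _ => V.of_card s (fun x hx => ?_) ⊥ ?_ N ?_ i hi⟩
  · rw [← hs]; exact Submodule.subset_span hx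
  · rw [← hs]; exact le_sup_right
  · intro x hx n
    exact ⟨1, by simp [(Submodule.mem_bot R).1 hx]⟩

lemma Ext_fg [IsNoetherianRing R] {N : Type u} [AddCommGroup N]
    [Module R N] (i : ℕ) : ∀ {X : Type u} [AddCommGroup X] [Module R X]
    [Module.Finite R X] (x : Abelian.Ext (ModuleCat.of R X) (ModuleCat.of R N) i),
    ∃ (N₀ : Submodule R N) (_ : N₀.FG) (y : Abelian.Ext (ModuleCat.of R X) (ModuleCat.of R N₀) i),
      y.comp (Abelian.Ext.mk₀ (incl N₀)) (add_zero _) = x := by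
  induction i with
  | zero =>
    intro X _ _ _ x
    obtain ⟨f, rfl⟩ := Abelian.Ext.homEquiv₀.symm.surjective x
    refine ⟨LinearMap.range f.hom, ?_, Abelian.Ext.mk₀ (ModuleCat.ofHom f.hom.rangeRestrict), ?_⟩
    · rw [LinearMap.range_eq_map]
      exact Submodule.FG.map _ Module.Finite.fg_top
    · rw [Abelian.Ext.mk₀_comp_mk₀]
      rfl
  | succ i ih =>
    intro X _ _ _ x
    obtain ⟨F, _, _, g, _, _, hg⟩ := exists_free (R := R) X
    have hS := mkSES (LinearMap.ker g).subtype g (Submodule.subtype_injective _) hg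
      (LinearMap.exact_subtype_ker_map g)
    have : Projective (ModuleCat.of R F) := inferInstance
    obtain ⟨y, hy⟩ := Abelian.Ext.contravariant_sequence_exact₃ hS _ x
      (Abelian.Ext.eq_zero_of_projective _) (add_comm 1 i)
    obtain ⟨N₀, hN₀, z, hz⟩ := ih y
    refine ⟨N₀, hN₀, hS.extClass.comp z (add_comm 1 i), ?_⟩
    rw [Abelian.Ext.comp_assoc _ _ _ (add_comm 1 i) (add_zero _) (by lia), hz, hy]

lemma V.of_fg [IsNoetherianRing R] {I : Ideal R} {i : ℕ} (N : Type u) [AddCommGroup N]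
    [Module R N] (h : ∀ N₀ : Submodule R N, N₀.FG → V I i (.of R N₀)) : V I i (.of R N) := by
  intro t x
  obtain ⟨N₀, hN₀, y, rfl⟩ := Ext_fg i x
  obtain ⟨t', ht, hy⟩ := h N₀ hN₀ t y
  exact ⟨t', ht, by rw [res_comp, hy, Abelian.Ext.zero_comp]⟩

end LC

namespace LC
universe u
open Opposite Limits
variable {R : Type u} [CommRing R]

open TensorProduct in
lemma exists_ne_zero_map [IsNoetherianRing R] {M : Type u} [AddCommGroup M] [Module R M]
    [Module.Finite R M] (p : PrimeSpectrum R) (hp : p ∈ Module.support R M) :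
    ∃ h : M →ₗ[R] R ⧸ p.asIdeal, h ≠ 0 := by
  rw [Module.mem_support_iff_nontrivial_residueField_tensorProduct] at hp
  let k := p.asIdeal.ResidueField
  obtain ⟨v, hv⟩ := exists_ne (0 : k ⊗[R] M)
  obtain ⟨φ, hφ⟩ : ∃ φ : Module.Dual k (k ⊗[R] M), φ v ≠ 0 := by
    by_contra! h
    exact hv ((Module.forall_dual_apply_eq_zero_iff k v).1 h)
  let ψ : M →ₗ[R] k := φ.restrictScalars R ∘ₗ TensorProduct.mk R k M 1
  have hψ : ∃ m, ψ m ≠ 0 := by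
    by_contra! h
    apply hφ
    have : φ = 0 := by
      apply TensorProduct.AlgebraTensorModule.curry_injective
      ext m
      exact h m
    rw [this]; rfl
  have hloc : IsLocalizedModule p.asIdeal.primeCompl
      (IsScalarTower.toAlgHom R (R ⧸ p.asIdeal) k).toLinearMap := by
    rw [isLocalizedModule_iff_isLocalization]
    have : Algebra.algebraMapSubmonoid (R ⧸ p.asIdeal) p.asIdeal.primeCompl =
        nonZeroDivisors (R ⧸ p.asIdeal) := by
      ext x
      obtain ⟨x, rfl⟩ := Ideal.Quotient.mk_surjective x
      rw [mem_nonZeroDivisors_iff_ne_zero, Ne, Ideal.Quotient.eq_zero_iff_mem]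
      constructor
      · rintro ⟨y, hy, hxy⟩ hx
        apply hy
        have h0 : Ideal.Quotient.mk p.asIdeal y = Ideal.Quotient.mk p.asIdeal x := hxy
        rw [Ideal.Quotient.eq_zero_iff_mem.2 hx, Ideal.Quotient.eq_zero_iff_mem] at h0
        exact h0
      · intro hx
        exact ⟨x, hx, rfl⟩
    rw [this]
    exact inferInstanceAs (IsFractionRing (R ⧸ p.asIdeal) p.asIdeal.ResidueField)
  have : Module.FinitePresentation R M := Module.finitePresentation_of_finite R M
  obtain ⟨h, s, hs⟩ := Module.FinitePresentation.exists_lift_of_isLocalizedModule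
    p.asIdeal.primeCompl (IsScalarTower.toAlgHom R (R ⧸ p.asIdeal) k).toLinearMap ψ
  refine ⟨h, ?_⟩
  rintro rfl
  obtain ⟨m, hm⟩ := hψ
  have h1 : 0 = (s : R) • ψ m := by
    have h0 := LinearMap.congr_fun hs m
    rw [LinearMap.comp_zero] at h0
    exact h0
  have h2 := (Module.End.isUnit_iff _).1 (IsLocalizedModule.map_units
    (IsScalarTower.toAlgHom R (R ⧸ p.asIdeal) k).toLinearMap s)
  exact hm (h2.1 (h1.symm.trans (smul_zero (s : R)).symm))

lemma V.filt [IsNoetherianRing R] {I : Ideal R} {i : ℕ} (Z : Set (PrimeSpectrum R))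
    (hZ : ∀ p ∈ Z, V I i (.of R (R ⧸ p.asIdeal))) (N : Type u) [AddCommGroup N] [Module R N]
    [hN : Module.Finite R N] (h : Module.support R N ⊆ Z) : V I i (.of R N) := by
  revert h
  induction hN using IsNoetherianRing.induction_on_isQuotientEquivQuotientPrime R with
  | subsingleton N => intro _; exact V.of_subsingleton N
  | quotient N p e =>
    intro h
    refine (hZ p (h ?_)).of_equiv e.symm
    rw [e.support_eq, Module.mem_support_iff_of_finite, Ideal.annihilator_quotient]
  | exact N₁ N₂ N₃ f g hf hg hfg h₁ h₃ =>
    intro h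
    exact V.mid' hf hg hfg (h₁ ((Module.support_subset_of_injective f hf).trans h))
      (h₃ ((Module.support_subset_of_surjective g hg).trans h))

lemma V.prime [IsNoetherianRing R] {I : Ideal R} {i : ℕ} (M : Type u) [AddCommGroup M]
    [Module R M] [Module.Finite R M] (hM : V I i (.of R M))
    (hs : ∀ (N : Type u) [AddCommGroup N] [Module R N],
      Module.support R N ⊆ Module.support R M → V I (i + 1) (.of R N))
    (p : PrimeSpectrum R) : p ∈ Module.support R M → V I i (.of R (R ⧸ p.asIdeal)) := by
  have wf : WellFounded (fun p q : PrimeSpectrum R => q.asIdeal < p.asIdeal) :=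
    InvImage.wf PrimeSpectrum.asIdeal (wellFounded_gt (α := Ideal R))
  induction p using wf.induction with | h p ih =>
  intro hp
  obtain ⟨h, hh⟩ := exists_ne_zero_map p hp
  have h1 : V I i (.of R (LinearMap.range h)) :=
    V.right' (Submodule.subtype_injective _) h.surjective_rangeRestrict
      (by rw [LinearMap.exact_iff, LinearMap.ker_rangeRestrict, Submodule.range_subtype])
      hM (hs (LinearMap.ker h)
        (Module.support_subset_of_injective _ (Submodule.subtype_injective _)))
  have h2 : V I i (.of R ((R ⧸ p.asIdeal) ⧸ LinearMap.range h)) := by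
    refine V.filt {q | p.asIdeal < q.asIdeal} (fun q hq => ih q hq ?_) _ ?_
    · exact Module.mem_support_mono (le_of_lt hq) hp
    · intro q hq
      have hq := Module.annihilator_le_of_mem_support hq
      obtain ⟨m, hm⟩ : ∃ m, h m ≠ 0 := by
        by_contra! h0
        exact hh (LinearMap.ext h0)
      obtain ⟨a, ha⟩ := Ideal.Quotient.mk_surjective (h m)
      refine lt_of_le_of_ne (a := p.asIdeal) (b := q.asIdeal) ?_ ?_
      · refine le_trans ?_ hq
        intro r hr
        rw [Module.mem_annihilator]
        intro n
        obtain ⟨n, rfl⟩ := Submodule.mkQ_surjective _ n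
        obtain ⟨n, rfl⟩ := Ideal.Quotient.mk_surjective n
        rw [← map_smul]
        have : r • Ideal.Quotient.mk p.asIdeal n = 0 := by
          change Ideal.Quotient.mk p.asIdeal (r * n) = 0
          rw [Ideal.Quotient.eq_zero_iff_mem]
          exact Ideal.mul_mem_right _ _ hr
        rw [this, map_zero]
      · intro heq
        apply hm
        rw [← ha, Ideal.Quotient.eq_zero_iff_mem, heq]
        apply hq
        rw [Module.mem_annihilator]
        intro n
        obtain ⟨n, rfl⟩ := Submodule.mkQ_surjective _ n
        obtain ⟨n, rfl⟩ := Ideal.Quotient.mk_surjective n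
        rw [← map_smul, Submodule.mkQ_apply, Submodule.Quotient.mk_eq_zero]
        have : a • Ideal.Quotient.mk p.asIdeal n = n • h m := by
          rw [← ha]
          change Ideal.Quotient.mk p.asIdeal (a * n) = Ideal.Quotient.mk p.asIdeal (n * a)
          rw [mul_comm]
        rw [this]
        exact Submodule.smul_mem _ _ ⟨m, rfl⟩
  exact V.mid' (Submodule.subtype_injective _) (Submodule.mkQ_surjective _)
    (LinearMap.exact_subtype_mkQ _) h1 h2

lemma V.main [IsNoetherianRing R] {I : Ideal R} (c : ℕ) (M : Type u) [AddCommGroup M]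
    [Module R M] [Module.Finite R M] (hM : ∀ i, c < i → V I i (.of R M)) (i : ℕ) (hi : c < i)
    (N : Type u) [AddCommGroup N] [Module R N]
    (h : Module.support R N ⊆ Module.support R M) : V I i (.of R N) := by
  obtain ⟨n, hn⟩ := V.eventually I
  have key : ∀ k i : ℕ, c < i → n < i + k → ∀ (N : Type u) [AddCommGroup N] [Module R N],
      Module.support R N ⊆ Module.support R M → V I i (.of R N) := by
    intro k
    induction k with
    | zero =>
      intro i _ hi N _ _ _
      exact hn i hi N
    | succ k ih =>
      intro i hi hk N _ _ h
      refine V.of_fg N fun N₀ hN₀ => ?_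
      have : Module.Finite R N₀ := Module.Finite.iff_fg.2 hN₀
      refine V.filt (Module.support R M) (V.prime M (hM i hi) (ih (i + 1) (by lia) (by lia))) N₀ ?_
      exact (Module.support_subset_of_injective _ (Submodule.subtype_injective _)).trans h
  exact key n i hi (by lia) N h

end LC

theorem stmt0 {R : Type u} [CommRing R] [IsNoetherianRing R] (I : Ideal R) (hI : I ≠ ⊤)
    (M N : Type u) [AddCommGroup M] [Module R M] [AddCommGroup N] [Module R N]
    [Module.Finite R M]
    (hsupp : Module.support R N ⊆ Module.support R M) (c : ℕ)
    (hM : ∀ i : ℕ, c < i → Subsingleton ((localCohomology I i).obj (ModuleCat.of R M))) :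
    ∀ i : ℕ, c < i → Subsingleton ((localCohomology I i).obj (ModuleCat.of R N)) := by
  have e : ∀ i : ℕ, c < i → ∀ X : ModuleCat.{u} R,
      (Subsingleton ((localCohomology I i).obj X) ↔ LC.V I i X) := by
    intro i hi X
    obtain ⟨j, rfl⟩ := Nat.exists_eq_succ_of_ne_zero (by lia : i ≠ 0)
    exact LC.subs_iff I j X
  intro i hi
  rw [e i hi]
  exact LC.V.main c M (fun j hj => (e j hj _).1 (hM j hj)) i hi N hsupp
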